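/- Assume case (BS3). If α ∈ Λ and θ(α) > 0, then α b^p ∈ Λ for every p ∈ ℤ. Moreover, every nonnegative power of b is an initial segment of α: for every m ∈ ℕ, α ∈ b^m Λ. -/

import Mathlib

inductive BSGen : Type
  | a : BSGen
  | b : BSGen

/-- The relations for the Baumslag–Solitar presentation `⟨a, b | a bᶜ = bᵉ a⟩`.
For cases (BS1), (BS2) take `e = d`; for case (BS3) take `e = -d`. -/
def BSRel (c e : ℤ) : Set (FreeGroup BSGen) :=
  {FreeGroup.of BSGen.a * FreeGroup.of BSGen.b ^ c *
    (FreeGroup.of BSGen.b ^ e * FreeGroup.of BSGen.a)⁻¹}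

/-- The Baumslag–Solitar group `Γ = ⟨a, b | a bᶜ = bᵉ a⟩`. -/
abbrev BSGroup (c e : ℤ) := PresentedGroup (BSRel c e)

/-- The generator `a` of `Γ`. -/
def bsa (c e : ℤ) : BSGroup c e := PresentedGroup.of BSGen.a

/-- The generator `b` of `Γ`. -/
def bsb (c e : ℤ) : BSGroup c e := PresentedGroup.of BSGen.b

/-- `Λ`, the submonoid of `Γ` generated by `a` and `b`. -/
def bsΛ (c e : ℤ) : Submonoid (BSGroup c e) :=
  Submonoid.closure {bsa c e, bsb c e}

theorem bsa_mem (c e : ℤ) : bsa c e ∈ bsΛ c e :=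
  Submonoid.subset_closure (by simp)

theorem bsb_mem (c e : ℤ) : bsb c e ∈ bsΛ c e :=
  Submonoid.subset_closure (by simp)

theorem bsb_zpow_mem (c e : ℤ) {z : ℤ} (hz : 0 ≤ z) : bsb c e ^ z ∈ bsΛ c e := by
  lift z to ℕ using hz
  rw [zpow_natCast]
  exact pow_mem (bsb_mem c e) z

theorem bsa_mul_bsb_zpow (c e : ℤ) : bsa c e * bsb c e ^ c = bsb c e ^ e * bsa c e := by
  have h := PresentedGroup.one_of_mem (rels := BSRel c e) (Set.mem_singleton _)
  rw [map_mul, map_inv, mul_inv_eq_one] at h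
  simp only [map_mul, map_zpow] at h
  exact h

theorem bsa_eq_zpow_mul_bsa_mul_zpow (c d : ℤ) (k : ℕ) :
    bsa c (-d) = bsb c (-d) ^ (d * k) * bsa c (-d) * bsb c (-d) ^ (c * k) := by
  induction k with
  | zero => simp
  | succ k ih =>
    have h : bsb c (-d) ^ d * bsa c (-d) * bsb c (-d) ^ c = bsa c (-d) := by
      rw [mul_assoc, bsa_mul_bsb_zpow, ← mul_assoc, ← zpow_add, add_neg_cancel, zpow_zero,
        one_mul]
    have hd : d * ((k + 1 : ℕ) : ℤ) = d * k + d := by push_cast; ring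
    have hc : c * ((k + 1 : ℕ) : ℤ) = c + c * k := by push_cast; ring
    rw [hd, hc, zpow_add, zpow_add]
    calc bsa c (-d) = bsb c (-d) ^ (d * k) * bsa c (-d) * bsb c (-d) ^ (c * k) := ih
      _ = bsb c (-d) ^ (d * k) * (bsb c (-d) ^ d * bsa c (-d) * bsb c (-d) ^ c) *
          bsb c (-d) ^ (c * k) := by rw [h]
      _ = _ := by simp only [mul_assoc]

theorem bsa_mul_zpow_mem (c d : ℤ) (hc : 0 < c) (hd : 0 < d) (p : ℤ) :
    bsa c (-d) * bsb c (-d) ^ p ∈ bsΛ c (-d) := by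
  rw [bsa_eq_zpow_mul_bsa_mul_zpow c d p.natAbs, mul_assoc, ← zpow_add]
  refine mul_mem (mul_mem (bsb_zpow_mem _ _ (by positivity)) (bsa_mem _ _))
    (bsb_zpow_mem _ _ ?_)
  rw [Int.natCast_natAbs]
  nlinarith [neg_abs_le p, abs_nonneg p]

theorem bsa_initial_segment (c d : ℤ) (hc : 0 < c) (hd : 0 < d) (m : ℕ) :
    ∃ γ ∈ bsΛ c (-d), bsa c (-d) = bsb c (-d) ^ m * γ := by
  refine ⟨bsb c (-d) ^ (d * m - m) * bsa c (-d) * bsb c (-d) ^ (c * m), ?_, ?_⟩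
  · refine mul_mem (mul_mem (bsb_zpow_mem _ _ ?_) (bsa_mem _ _))
      (bsb_zpow_mem _ _ (by positivity))
    nlinarith [Int.natCast_nonneg m]
  · rw [← mul_assoc, ← mul_assoc, ← zpow_natCast, ← zpow_add, add_sub_cancel]
    exact bsa_eq_zpow_mul_bsa_mul_zpow c d m

theorem eq_pow_or_absorbs (c d : ℤ) (hc : 0 < c) (hd : 0 < d)
    (α : BSGroup c (-d)) (hα : α ∈ bsΛ c (-d)) :
    (∃ n : ℕ, α = bsb c (-d) ^ n) ∨
    ((∀ p : ℤ, α * bsb c (-d) ^ p ∈ bsΛ c (-d)) ∧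
      (∀ m : ℕ, ∃ γ ∈ bsΛ c (-d), α = bsb c (-d) ^ m * γ)) := by
  induction hα using Submonoid.closure_induction with
  | mem x hx =>
    rcases hx with rfl | rfl
    · exact .inr ⟨bsa_mul_zpow_mem c d hc hd, bsa_initial_segment c d hc hd⟩
    · exact .inl ⟨1, (pow_one _).symm⟩
  | one => exact .inl ⟨0, (pow_zero _).symm⟩
  | mul x y hx hy ihx ihy =>
    rcases ihx with ⟨n, rfl⟩ | ⟨hxr, hxl⟩
    · rcases ihy with ⟨k, rfl⟩ | ⟨hyr, hyl⟩
      · exact .inl ⟨n + k, (pow_add _ _ _).symm⟩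
      · refine .inr ⟨fun p => ?_, fun m => ?_⟩
        · rw [mul_assoc]
          exact mul_mem hx (hyr p)
        · obtain ⟨γ, hγ, rfl⟩ := hyl m
          exact ⟨_, mul_mem hx hγ, by rw [← mul_assoc, ← mul_assoc, pow_mul_comm]⟩
    · refine .inr ⟨fun p => ?_, fun m => ?_⟩
      · rcases ihy with ⟨k, rfl⟩ | ⟨hyr, -⟩
        · rw [mul_assoc, ← zpow_natCast, ← zpow_add]
          exact hxr _
        · rw [mul_assoc]
          exact mul_mem hx (hyr p)
      · obtain ⟨γ, hγ, h⟩ := hxl m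
        exact ⟨γ * y, mul_mem hγ hy, by rw [← mul_assoc, ← h]⟩

/-- Case (BS3): if `α ∈ Λ` and `θ(α) > 0`, then `α bᵖ ∈ Λ` for every `p ∈ ℤ`, and every
nonnegative power of `b` is an initial segment of `α`: for every `m ∈ ℕ`, `α ∈ bᵐ Λ`. -/
theorem statement4 (c d : ℤ) (hc : 0 < c) (hd : 0 < d)
    (θ : BSGroup c (-d) → ℤ) (hθ : ∀ x y, θ (x * y) = θ x + θ y)
    (hθa : θ (bsa c (-d)) = 1) (hθb : θ (bsb c (-d)) = 0)
    (α : BSGroup c (-d)) (hα : α ∈ bsΛ c (-d)) (hpos : 0 < θ α) :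
    (∀ p : ℤ, α * bsb c (-d) ^ p ∈ bsΛ c (-d)) ∧
    (∀ m : ℕ, ∃ γ ∈ bsΛ c (-d), α = bsb c (-d) ^ m * γ) := by
  rcases eq_pow_or_absorbs c d hc hd α hα with ⟨n, rfl⟩ | h
  · have h_pow (k : ℕ) : θ (bsb c (-d) ^ k) = 0 := by
      induction k with
      | zero => simpa using hθ 1 1
      | succ k ih => rw [pow_succ, hθ, ih, hθb, add_zero]
    exact absurd (h_pow n) hpos.ne'
  · exact h
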